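/- Let 0 < β < 1 and let n ≥ 1. Then the first-order stable spline kernel matrix K_β ∈ ℝ^{n×n}, with entries (K_β)_{ij} = β^{max(i,j)} for 1 ≤ i, j ≤ n, is symmetric positive definite. -/

import Mathlib

open Matrix

theorem sum_range_ite_pow_sub_pow (β : ℝ) (m n : ℕ) :
    ∑ k ∈ Finset.range n, (if m ≤ k then β ^ (k + 1) - β ^ (k + 2) else 0) =
      if m ≤ n then β ^ (m + 1) - β ^ (n + 1) else 0 := by
  induction n with
  | zero =>
    split_ifs with h
    · simp [Nat.le_zero.mp h]
    · simp
  | succ n ih =>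
    rw [Finset.sum_range_succ, ih]
    rcases lt_trichotomy m (n + 1) with h | rfl | h
    · simp [Nat.lt_succ_iff.mp h, h.le]
    · simp
    · simp [show ¬ m ≤ n by omega, show ¬ m ≤ n + 1 by omega]

/-- The upper-triangular factorization `Uᴴ D U` of the stable spline kernel matrix, with
`D` diagonal and `U` the matrix of partial sums. -/
theorem stableSpline_eq_conjTranspose_mul_diagonal_mul (β : ℝ) (N : ℕ) :
    (Matrix.of fun i j : Fin (N + 1) => β ^ (max (i : ℕ) (j : ℕ) + 1)) =
      (Matrix.of fun k i : Fin (N + 1) => if i ≤ k then (1 : ℝ) else 0)ᴴ *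
        diagonal (fun k : Fin (N + 1) =>
          if (k : ℕ) = N then β ^ (N + 1) else β ^ ((k : ℕ) + 1) - β ^ ((k : ℕ) + 2)) *
        (Matrix.of fun k i : Fin (N + 1) => if i ≤ k then (1 : ℝ) else 0) := by
  ext i j
  have hm : max (i : ℕ) (j : ℕ) ≤ N := by omega
  have h := sum_range_ite_pow_sub_pow β (max (i : ℕ) (j : ℕ)) N
  rw [if_pos hm, Finset.sum_range] at h
  have hi : i ≤ Fin.last N := Fin.le_last i
  have hj : j ≤ Fin.last N := Fin.le_last j
  rw [mul_apply, Fin.sum_univ_castSucc]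
  simp only [mul_diagonal, conjTranspose_apply, of_apply, hi, hj, Fin.val_last, if_true,
    star_one, one_mul, mul_one]
  rw [← sub_eq_iff_eq_add, ← h]
  refine Finset.sum_congr rfl fun k _ => ?_
  have hk : (k : ℕ) ≠ N := k.isLt.ne
  have hle (l : Fin (N + 1)) : l ≤ k.castSucc ↔ (l : ℕ) ≤ k := Iff.rfl
  simp only [hle, max_le_iff, Fin.val_castSucc, hk, if_false]
  by_cases h₁ : (i : ℕ) ≤ k <;> by_cases h₂ : (j : ℕ) ≤ k <;> simp [h₁, h₂]

/-- For `0 < β < 1` and `n ≥ 1`, the first-order stable spline kernel matrix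
`K_β` with entries `(K_β)_{ij} = β^{max(i,j)}` (indices `1 ≤ i, j ≤ n`; here
0-based, so the entry is `β^(max i j + 1)`) is symmetric positive definite. -/
theorem stmt12 (β : ℝ) (hβ0 : 0 < β) (hβ1 : β < 1) (n : ℕ) (hn : 1 ≤ n) :
    (Matrix.of fun i j : Fin n => β ^ (max (i : ℕ) (j : ℕ) + 1)).PosDef := by
  obtain ⟨N, rfl⟩ := Nat.exists_eq_add_of_le' hn
  rw [stableSpline_eq_conjTranspose_mul_diagonal_mul]
  refine PosDef.conjTranspose_mul_mul_same (PosDef.diagonal fun k => ?_) ?_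
  · split_ifs
    · positivity
    · exact sub_pos.mpr (pow_lt_pow_right_of_lt_one₀ hβ0 hβ1 (by omega))
  · refine mulVec_injective_of_isUnit ((isUnit_iff_isUnit_det _).mpr ?_)
    rw [det_of_isLowerTriangular]
    · simp
    · intro i j hij
      simpa using hij
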